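/- (Weak converse with √n penalty.) For every ε ∈ (0, 1/2) there exists a constant K > 0 and an integer n₀ such that for all n ≥ n₀, log M*_f(n, ε) ≤ nC + K√n. -/

import Mathlib

open Finset

noncomputable section

variable {𝒳 𝒴 : Type*} [Fintype 𝒳] [Fintype 𝒴]

/-- `P` is a probability distribution on the finite alphabet `𝒳`. -/
def IsDist (P : 𝒳 → ℝ) : Prop := (∀ x, 0 ≤ P x) ∧ ∑ x, P x = 1

/-- The output distribution `PW` induced by input distribution `P` and channel `W`. -/
def outDist (P : 𝒳 → ℝ) (W : 𝒳 → 𝒴 → ℝ) (y : 𝒴) : ℝ := ∑ x, P x * W x y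

/-- The mutual information `I(P, W)` (natural logarithm). -/
def mutInfo (P : 𝒳 → ℝ) (W : 𝒳 → 𝒴 → ℝ) : ℝ :=
  ∑ x, ∑ y, P x * W x y * Real.log (W x y / outDist P W y)

/-- Relative entropy (KL divergence) between two pmfs on a finite alphabet. -/
def relEnt (p q : 𝒴 → ℝ) : ℝ := ∑ y, p y * Real.log (p y / q y)

/-- Directional derivative `∇I_k(v)` of the mutual information at `P*` along `v`. -/
def gradI (Pstar : 𝒳 → ℝ) (W : 𝒳 → 𝒴 → ℝ) (v : 𝒳 → ℝ) : ℝ :=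
  ∑ x, v x * relEnt (W x) (outDist Pstar W)


/-- Per-symbol information density `i_{P,W}(x;y)`. -/
def infoDens (P : 𝒳 → ℝ) (W : 𝒳 → 𝒴 → ℝ) (x : 𝒳) (y : 𝒴) : ℝ :=
  Real.log (W x y / outDist P W y)

/-- Causality of a feedback encoder: the input at time `i` depends on the message and
on the channel outputs at times `< i` only. -/
def Causal (n M : ℕ) (f : Fin M → (Fin n → 𝒴) → (Fin n → 𝒴) → Fin n → 𝒳) : Prop :=
  ∀ (j : Fin M) (y1 y1' y2 y2' : Fin n → 𝒴) (i : Fin n),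
    (∀ t, t < i → y1 t = y1' t) → (∀ t, t < i → y2 t = y2' t) →
      f j y1 y2 i = f j y1' y2' i

/-- The joint law `ℙ(j, y₁ⁿ, y₂ⁿ)` induced by an FLF code:
`(1/M) ∏ᵢ W₁(y₁ᵢ | fᵢ(j, y₁^{i-1}, y₂^{i-1})) W₂(y₂ᵢ | fᵢ(j, y₁^{i-1}, y₂^{i-1}))`. -/
def codeLaw (W1 W2 : 𝒳 → 𝒴 → ℝ) (n M : ℕ)
    (f : Fin M → (Fin n → 𝒴) → (Fin n → 𝒴) → Fin n → 𝒳)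
    (j : Fin M) (y1 y2 : Fin n → 𝒴) : ℝ :=
  (1 / M) * ∏ i, (W1 (f j y1 y2 i) (y1 i) * W2 (f j y1 y2 i) (y2 i))

/-- Error probability `ℙ[g(Y₁ⁿ) ≠ J]` at decoder 1. -/
def errProb1 (W1 W2 : 𝒳 → 𝒴 → ℝ) (n M : ℕ)
    (f : Fin M → (Fin n → 𝒴) → (Fin n → 𝒴) → Fin n → 𝒳)
    (g : (Fin n → 𝒴) → Fin M) : ℝ :=
  ∑ j, ∑ y1 : Fin n → 𝒴, ∑ y2 : Fin n → 𝒴,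
    if g y1 = j then 0 else codeLaw W1 W2 n M f j y1 y2

/-- Error probability `ℙ[g(Y₂ⁿ) ≠ J]` at decoder 2. -/
def errProb2 (W1 W2 : 𝒳 → 𝒴 → ℝ) (n M : ℕ)
    (f : Fin M → (Fin n → 𝒴) → (Fin n → 𝒴) → Fin n → 𝒳)
    (g : (Fin n → 𝒴) → Fin M) : ℝ :=
  ∑ j, ∑ y1 : Fin n → 𝒴, ∑ y2 : Fin n → 𝒴,
    if g y2 = j then 0 else codeLaw W1 W2 n M f j y1 y2

/-- Per-symbol conditional variance `Var_{Y ∼ W(·|x)}(i_{P,W}(x;Y))`. -/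
def symbVar (P : 𝒳 → ℝ) (W : 𝒳 → 𝒴 → ℝ) (x : 𝒳) : ℝ :=
  ∑ y, W x y * (infoDens P W x y - ∑ y', W x y' * infoDens P W x y') ^ 2

/-- Conditional information variance `V(P) = Σₓ P(x) Var_{Y∼W(·|x)}(i_{P,W}(x;Y))`. -/
def condInfoVar (P : 𝒳 → ℝ) (W : 𝒳 → 𝒴 → ℝ) : ℝ := ∑ x, P x * symbVar P W x

/-- Existence of an `(n, M, ε)` fixed-length feedback code. -/
def FLFExists (W1 W2 : 𝒳 → 𝒴 → ℝ) (n M : ℕ) (ε : ℝ) : Prop :=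
  ∃ f : Fin M → (Fin n → 𝒴) → (Fin n → 𝒴) → Fin n → 𝒳,
    Causal n M f ∧
      ∃ g1 g2 : (Fin n → 𝒴) → Fin M,
        errProb1 W1 W2 n M f g1 ≤ ε ∧ errProb2 W1 W2 n M f g2 ≤ ε

/-- `M*_f(n, ε)`: the maximum code size of `(n, M, ε)`-FLF codes. -/
noncomputable def MstarF (W1 W2 : 𝒳 → 𝒴 → ℝ) (n : ℕ) (ε : ℝ) : ℕ :=
  sSup {M | FLFExists W1 W2 n M ε}

/-- The Gaussian tail function `Q(t)`. -/
noncomputable def Qfun (t : ℝ) : ℝ :=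
  ∫ u in Set.Ioi t, Real.exp (-u ^ 2 / 2) / Real.sqrt (2 * Real.pi)

/-- The inverse `Q⁻¹` of the Gaussian tail function (on `(0,1)`). -/
noncomputable def Qinv : ℝ → ℝ := Function.invFun Qfun

/-- A sum over `Fin (n + 1)`-indexed words splits into the first letter and the remaining word. -/
lemma sum_words_succ {Z : Type*} [Fintype Z] {n : ℕ} (F : (Fin (n + 1) → Z) → ℝ) :
    ∑ z, F z = ∑ a, ∑ w : Fin n → Z, F (Fin.cons a w) := by
  rw [← Fintype.sum_prod_type']
  exact (Fintype.sum_equiv (Fin.consEquiv fun _ => Z) (fun q => F (Fin.cons q.1 q.2)) F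
    fun _ => rfl).symm

/-- For a causally controlled channel, the word law has total mass one, and a sum of
conditionally centred increments has mean zero and second moment at most `n * V`. -/
lemma causal_moments {Z X : Type*} [Fintype Z] [Nonempty Z] (K : X → Z → ℝ) (hK : ∀ x z, 0 ≤ K x z)
    (hKsum : ∀ x, ∑ z, K x z = 1) (d : X → Z → ℝ) (V : ℝ)
    (hd : ∀ x, ∑ z, K x z * d x z = 0) (hV : ∀ x, ∑ z, K x z * d x z ^ 2 ≤ V) (n : ℕ) :
    ∀ f : (Fin n → Z) → Fin n → X,
      (∀ z z' i, (∀ t, t < i → z t = z' t) → f z i = f z' i) →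
      (∑ z, ∏ i, K (f z i) (z i) = 1) ∧
      (∑ z, (∏ i, K (f z i) (z i)) * ∑ i, d (f z i) (z i) = 0) ∧
      (∑ z, (∏ i, K (f z i) (z i)) * (∑ i, d (f z i) (z i)) ^ 2 ≤ n * V) := by
  induction n with
  | zero => intro f _; simp
  | succ n ih =>
    intro f hf
    obtain ⟨z₀⟩ := ‹Nonempty Z›
    set x₀ := f (fun _ => z₀) 0
    have h0 : ∀ z, f z 0 = x₀ := fun z => hf _ _ _ fun t ht => absurd ht (Fin.not_lt_zero t)
    have hrest : ∀ a, _ := fun a => ih (fun w i => f (Fin.cons a w) i.succ) (by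
      intro w w' i h
      refine hf _ _ _ fun t => ?_
      refine Fin.cases (fun _ => by simp) (fun s hs => ?_) t
      simpa using h s (Fin.succ_lt_succ_iff.mp hs))
    simp only [sum_words_succ, Fin.prod_univ_succ, Fin.sum_univ_succ, h0, Fin.cons_zero,
      Fin.cons_succ]
    set P : Z → (Fin n → Z) → ℝ := fun a w => ∏ i, K (f (Fin.cons a w) i.succ) (w i) with hP
    set R : Z → (Fin n → Z) → ℝ := fun a w => ∑ i, d (f (Fin.cons a w) i.succ) (w i) with hR
    have e0 : ∀ a, ∑ w, P a w = 1 := fun a => (hrest a).1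
    have e1 : ∀ a, ∑ w, P a w * R a w = 0 := fun a => (hrest a).2.1
    have e2 : ∀ a, ∑ w, P a w * R a w ^ 2 ≤ n * V := fun a => (hrest a).2.2
    refine ⟨?_, ?_, ?_⟩
    · calc _ = ∑ a, K x₀ a * ∑ w, P a w := by simp only [mul_sum, hP]
        _ = 1 := by simp [e0, hKsum]
    · calc ∑ a, ∑ w, K x₀ a * P a w * (d x₀ a + R a w)
          = ∑ a, (K x₀ a * d x₀ a * ∑ w, P a w + K x₀ a * ∑ w, P a w * R a w) := by
            refine sum_congr rfl fun a _ => ?_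
            rw [mul_sum, mul_sum, ← sum_add_distrib]
            exact sum_congr rfl fun w _ => by ring
        _ = 0 := by simp [e0, e1, hd]
    · calc ∑ a, ∑ w, K x₀ a * P a w * (d x₀ a + R a w) ^ 2
          = ∑ a, (K x₀ a * d x₀ a ^ 2 * ∑ w, P a w + 2 * K x₀ a * d x₀ a * ∑ w, P a w * R a w
              + K x₀ a * ∑ w, P a w * R a w ^ 2) := by
            refine sum_congr rfl fun a _ => ?_
            rw [mul_sum, mul_sum, mul_sum, ← sum_add_distrib, ← sum_add_distrib]
            exact sum_congr rfl fun w _ => by ring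
        _ ≤ ∑ a, (K x₀ a * d x₀ a ^ 2 + K x₀ a * (n * V)) := by
            refine sum_le_sum fun a _ => ?_
            rw [e0, e1]
            linarith [mul_le_mul_of_nonneg_left (e2 a) (hK x₀ a)]
        _ ≤ (n + 1 : ℕ) * V := by
            rw [sum_add_distrib, ← sum_mul, hKsum]
            push_cast
            linarith [hV x₀]

lemma outDist_pos {X Y : Type*} [Fintype X] {P : X → ℝ} (hP : ∀ x, 0 < P x) {W : X → Y → ℝ}
    (hW : ∀ x y, 0 ≤ W x y) {x : X} {y : Y} (h : 0 < W x y) : 0 < outDist P W y :=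
  sum_pos' (fun x _ => mul_nonneg (hP x).le (hW x y)) ⟨x, mem_univ x, mul_pos (hP x) h⟩

lemma outDist_nonneg {X Y : Type*} [Fintype X] {P : X → ℝ} (hP : ∀ x, 0 ≤ P x) {W : X → Y → ℝ}
    (hW : ∀ x y, 0 ≤ W x y) (y : Y) : 0 ≤ outDist P W y :=
  sum_nonneg fun x _ => mul_nonneg (hP x) (hW x y)

lemma sum_outDist {P : 𝒳 → ℝ} (hP : ∑ x, P x = 1) {W : 𝒳 → 𝒴 → ℝ}
    (hW : ∀ x, ∑ y, W x y = 1) : ∑ y, outDist P W y = 1 := by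
  unfold outDist
  rw [sum_comm]
  simp [← mul_sum, hW, hP]

/-- Relative entropy is bounded by the `χ²`-divergence. -/
lemma relEnt_le_chiSq {p q : 𝒴 → ℝ} (hp : ∀ y, 0 ≤ p y) (hq : ∀ y, 0 ≤ q y)
    (hpq : ∀ y, 0 < p y → 0 < q y) (hps : ∑ y, p y = 1) (hqs : ∑ y, q y = 1) :
    relEnt p q ≤ ∑ y, (p y - q y) ^ 2 / q y := by
  have h : ∀ y, p y * Real.log (p y / q y) ≤ (p y - q y) ^ 2 / q y + (p y - q y) := by
    intro y
    rcases (hp y).eq_or_lt with h0 | h0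
    · rw [← h0]
      rcases (hq y).eq_or_lt with h1 | h1
      · simp [← h1]
      · have : (0 - q y) ^ 2 / q y = q y := by field_simp; ring
        rw [this]; simp
    · have h1 := hpq y h0
      have h2 := mul_le_mul_of_nonneg_left (Real.log_le_sub_one_of_pos (div_pos h0 h1)) h0.le
      have h3 : (p y - q y) ^ 2 / q y + (p y - q y) = p y * (p y / q y - 1) := by
        field_simp; ring
      rw [h3]; exact h2
  calc relEnt p q ≤ ∑ y, ((p y - q y) ^ 2 / q y + (p y - q y)) := sum_le_sum fun y _ => h y
    _ = _ := by rw [sum_add_distrib, sum_sub_distrib, hps, hqs]; ring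

/-- The golden formula `I(P, W) = D(W ‖ QW | P) - D(PW ‖ QW)` for a full-support `Q`. -/
lemma mutInfo_eq_sub {P Q : 𝒳 → ℝ} (hP : ∀ x, 0 ≤ P x) (hQ : ∀ x, 0 < Q x) {W : 𝒳 → 𝒴 → ℝ}
    (hW : ∀ x y, 0 ≤ W x y) :
    mutInfo P W = ∑ x, P x * relEnt (W x) (outDist Q W)
      - relEnt (outDist P W) (outDist Q W) := by
  have h2 : relEnt (outDist P W) (outDist Q W)
      = ∑ x, ∑ y, P x * W x y * Real.log (outDist P W y / outDist Q W y) := by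
    unfold relEnt
    rw [sum_comm]
    refine sum_congr rfl fun y _ => ?_
    rw [← sum_mul]; rfl
  rw [h2, ← sum_sub_distrib]
  refine sum_congr rfl fun x _ => ?_
  rw [relEnt, mul_sum, ← sum_sub_distrib]
  refine sum_congr rfl fun y _ => ?_
  rcases (mul_nonneg (hP x) (hW x y)).eq_or_lt with h0 | h0
  · rw [← mul_assoc, ← h0]; simp
  · have hw : 0 < W x y := pos_of_mul_pos_right h0 (hP x)
    have hq := outDist_pos hQ hW hw
    have hp : 0 < outDist P W y :=
      sum_pos' (fun x _ => mul_nonneg (hP x) (hW x y)) ⟨x, mem_univ x, h0⟩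
    rw [Real.log_div hw.ne' hp.ne', Real.log_div hw.ne' hq.ne', Real.log_div hp.ne' hq.ne']
    ring

/-- A second-order lower bound of mutual information along a segment issuing from `P`. -/
lemma mutInfo_segment_ge {P Q : 𝒳 → ℝ} (hP : IsDist P) (hPpos : ∀ x, 0 < P x) (hQ : IsDist Q)
    {W : 𝒳 → 𝒴 → ℝ} (hW : ∀ x y, 0 ≤ W x y) (hWsum : ∀ x, ∑ y, W x y = 1)
    {t : ℝ} (ht0 : 0 ≤ t) (ht1 : t ≤ 1) :
    (1 - t) * mutInfo P W + t * ∑ x, Q x * relEnt (W x) (outDist P W)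
      - t ^ 2 * ∑ y, (outDist Q W y - outDist P W y) ^ 2 / outDist P W y
      ≤ mutInfo (fun x => (1 - t) * P x + t * Q x) W := by
  have hR0 : ∀ x, 0 ≤ (1 - t) * P x + t * Q x := fun x =>
    add_nonneg (mul_nonneg (by linarith) (hP.1 x)) (mul_nonneg ht0 (hQ.1 x))
  have hR1 : ∑ x, ((1 - t) * P x + t * Q x) = 1 := by
    rw [sum_add_distrib, ← mul_sum, ← mul_sum, hP.2, hQ.2]; ring
  have hout : ∀ y, outDist (fun x => (1 - t) * P x + t * Q x) W y
      = (1 - t) * outDist P W y + t * outDist Q W y := by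
    intro y
    unfold outDist
    rw [mul_sum, mul_sum, ← sum_add_distrib]
    exact sum_congr rfl fun x _ => by ring
  have hPP : mutInfo P W = ∑ x, P x * relEnt (W x) (outDist P W) :=
    sum_congr rfl fun x _ => by
      rw [relEnt, mul_sum]; exact sum_congr rfl fun y _ => by ring
  rw [mutInfo_eq_sub hR0 hPpos hW]
  have hchi := relEnt_le_chiSq (outDist_nonneg hR0 hW) (outDist_nonneg hP.1 hW)
    (fun y hy => by
      obtain ⟨x, -, hx⟩ := exists_ne_zero_of_sum_ne_zero hy.ne'
      exact outDist_pos hPpos hW ((hW x y).lt_of_ne' (right_ne_zero_of_mul hx)))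
    (sum_outDist hR1 hWsum) (sum_outDist hP.2 hWsum)
  have e1 : ∑ y, (outDist (fun x => (1 - t) * P x + t * Q x) W y - outDist P W y) ^ 2
      / outDist P W y = t ^ 2 * ∑ y, (outDist Q W y - outDist P W y) ^ 2 / outDist P W y := by
    rw [mul_sum]
    refine sum_congr rfl fun y _ => ?_
    rw [hout]; ring
  have e2 : ∑ x, ((1 - t) * P x + t * Q x) * relEnt (W x) (outDist P W)
      = (1 - t) * mutInfo P W + t * ∑ x, Q x * relEnt (W x) (outDist P W) := by
    rw [hPP, mul_sum, mul_sum, ← sum_add_distrib]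
    exact sum_congr rfl fun x _ => by ring
  rw [e1] at hchi
  rw [e2]
  linarith

/-- Kuhn–Tucker condition: some convex combination of the two divergences to the
optimal output distributions is bounded by the capacity at every input letter. -/
lemma exists_multiplier {W1 W2 : 𝒳 → 𝒴 → ℝ}
    (hW1 : ∀ x y, 0 ≤ W1 x y) (hW1sum : ∀ x, ∑ y, W1 x y = 1)
    (hW2 : ∀ x y, 0 ≤ W2 x y) (hW2sum : ∀ x, ∑ y, W2 x y = 1)
    {P : 𝒳 → ℝ} {C : ℝ} (hP : IsDist P) (hPpos : ∀ x, 0 < P x)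
    (hCach : min (mutInfo P W1) (mutInfo P W2) = C)
    (hCmax : ∀ P, IsDist P → min (mutInfo P W1) (mutInfo P W2) ≤ C) :
    ∃ l : ℝ, 0 ≤ l ∧ l ≤ 1 ∧ ∀ x, l * relEnt (W1 x) (outDist P W1)
      + (1 - l) * relEnt (W2 x) (outDist P W2) ≤ C := by
  set a : 𝒳 → ℝ := fun x => relEnt (W1 x) (outDist P W1) with ha
  set b : 𝒳 → ℝ := fun x => relEnt (W2 x) (outDist P W2) with hb
  have key : ∀ Q, IsDist Q → ¬ (C < ∑ x, Q x * a x ∧ C < ∑ x, Q x * b x) := by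
    rintro Q hQ ⟨h1, h2⟩
    obtain ⟨B, hB1, hB2, hB⟩ : ∃ B : ℝ,
        ∑ y, (outDist Q W1 y - outDist P W1 y) ^ 2 / outDist P W1 y ≤ B ∧
        ∑ y, (outDist Q W2 y - outDist P W2 y) ^ 2 / outDist P W2 y ≤ B ∧ 0 < B :=
      ⟨max (max _ _) 1, (le_max_left _ _).trans (le_max_left _ _),
        (le_max_right _ _).trans (le_max_left _ _), one_pos.trans_le (le_max_right _ _)⟩
    obtain ⟨η, hη, hη1, hη2⟩ : ∃ η : ℝ, 0 < η ∧ C + η ≤ ∑ x, Q x * a x ∧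
        C + η ≤ ∑ x, Q x * b x :=
      ⟨min (∑ x, Q x * a x - C) (∑ x, Q x * b x - C), lt_min (by linarith) (by linarith),
        by linarith [min_le_left (∑ x, Q x * a x - C) (∑ x, Q x * b x - C)],
        by linarith [min_le_right (∑ x, Q x * a x - C) (∑ x, Q x * b x - C)]⟩
    obtain ⟨t, ht0, ht1, htB⟩ : ∃ t : ℝ, 0 < t ∧ t ≤ 1 ∧ t * B < η :=
      ⟨min 1 (η / (2 * B)), lt_min one_pos (by positivity), min_le_left _ _, by
        calc _ ≤ η / (2 * B) * B := mul_le_mul_of_nonneg_right (min_le_right _ _) hB.le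
          _ = η / 2 := by field_simp
          _ < η := by linarith⟩
    have hlow : ∀ I s χ : ℝ, C ≤ I → C + η ≤ s → χ ≤ B →
        C < (1 - t) * I + t * s - t ^ 2 * χ := by
      intro I s χ hI hs hχ
      have i1 := mul_le_mul_of_nonneg_left hI (sub_nonneg.2 ht1)
      have i2 := mul_le_mul_of_nonneg_left hs ht0.le
      have i3 := mul_le_mul_of_nonneg_left hχ (sq_nonneg t)
      have i4 := mul_lt_mul_of_pos_left htB ht0
      nlinarith
    have hR : IsDist (fun x => (1 - t) * P x + t * Q x) :=
      ⟨fun x => add_nonneg (mul_nonneg (by linarith) (hP.1 x)) (mul_nonneg ht0.le (hQ.1 x)), by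
        rw [sum_add_distrib, ← mul_sum, ← mul_sum, hP.2, hQ.2]; ring⟩
    refine (hCmax _ hR).not_gt (lt_min ?_ ?_)
    · exact (hlow _ _ _ (hCach ▸ min_le_left _ _) hη1 hB1).trans_le
        (mutInfo_segment_ge hP hPpos hQ hW1 hW1sum ht0.le ht1)
    · exact (hlow _ _ _ (hCach ▸ min_le_right _ _) hη2 hB2).trans_le
        (mutInfo_segment_ge hP hPpos hQ hW2 hW2sum ht0.le ht1)
  have hlin : IsLinearMap ℝ fun Q : 𝒳 → ℝ => (∑ x, Q x * a x, ∑ x, Q x * b x) :=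
    ⟨fun Q R => by simp [add_mul, sum_add_distrib], fun c Q => by simp [mul_sum, mul_assoc]⟩
  have hdisj : Disjoint (Set.Ioi C ×ˢ Set.Ioi C)
      ((fun Q : 𝒳 → ℝ => (∑ x, Q x * a x, ∑ x, Q x * b x)) '' stdSimplex ℝ 𝒳) := by
    rw [Set.disjoint_left]
    rintro _ ⟨hu, hv⟩ ⟨Q, hQ, rfl⟩
    exact key Q hQ ⟨hu, hv⟩
  obtain ⟨φ, u, hφ1, hφ2⟩ := geometric_hahn_banach_open
    ((convex_Ioi C).prod (convex_Ioi C)) (isOpen_Ioi.prod isOpen_Ioi)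
    ((convex_stdSimplex ℝ 𝒳).is_linear_image hlin) hdisj
  obtain ⟨α, β, hφ⟩ : ∃ α β : ℝ, ∀ s t : ℝ, φ (s, t) = α * s + β * t := by
    refine ⟨φ (1, 0), φ (0, 1), fun s t => ?_⟩
    have : ((s, t) : ℝ × ℝ) = s • (1, 0) + t • (0, 1) := by simp
    rw [this, map_add, map_smul, map_smul, smul_eq_mul, smul_eq_mul]
    ring
  have h1 : ∀ s t : ℝ, 0 < s → 0 < t → α * (C + s) + β * (C + t) < u := fun s t hs ht => by
    rw [← hφ]
    exact hφ1 _ ⟨by simpa using hs, by simpa using ht⟩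
  have h2 : ∀ x, u ≤ α * a x + β * b x := fun x => by
    classical
    have := hφ2 _ ⟨Pi.single x 1, single_mem_stdSimplex ℝ x, rfl⟩
    simpa [hφ, Pi.single_apply] using this
  have hα : α ≤ 0 := by
    by_contra! h
    have h3 := h1 ((|u - α * C - β * (C + 1)| + 1) / α) 1 (by positivity) one_pos
    rw [mul_add, mul_div_cancel₀ _ h.ne'] at h3
    linarith [le_abs_self (u - α * C - β * (C + 1))]
  have hβ : β ≤ 0 := by
    by_contra! h
    have h3 := h1 1 ((|u - β * C - α * (C + 1)| + 1) / β) one_pos (by positivity)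
    rw [mul_add β, mul_div_cancel₀ _ h.ne'] at h3
    linarith [le_abs_self (u - β * C - α * (C + 1))]
  have hu : (α + β) * C ≤ u := by
    by_contra! h
    have hs : 0 < ((α + β) * C - u) / (1 - α - β) := div_pos (by linarith) (by linarith)
    have h3 := h1 _ _ hs hs
    have h4 := div_mul_cancel₀ ((α + β) * C - u) (by linarith : 1 - α - β ≠ 0)
    nlinarith
  have hne : α + β < 0 := by
    refine lt_of_le_of_ne (by linarith) fun h => ?_
    obtain ⟨x⟩ : Nonempty 𝒳 := by
      by_contra! h
      have := hP.2
      simp at this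
    have hα0 : α = 0 := by linarith
    have hβ0 : β = 0 := by linarith
    have h3 := h1 1 1 one_pos one_pos
    have h4 := h2 x
    simp only [hα0, hβ0, zero_mul, add_zero] at h3 h4
    linarith
  refine ⟨α / (α + β), div_nonneg_of_nonpos hα hne.le,
    (div_le_one_of_neg hne).2 (by linarith), fun x => ?_⟩
  have h3 : α / (α + β) * a x + (1 - α / (α + β)) * b x = (α * a x + β * b x) / (α + β) := by
    have := hne.ne
    field_simp
    ring
  rw [h3, div_le_iff_of_neg hne]
  linarith [h2 x]

/-- If the accumulated information density is at most `c`, the channel law is at most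
`exp c` times the product output law. -/
lemma prod_le_exp_mul_prod {X Y : Type*} [Fintype X] {P : X → ℝ} (hP : ∀ x, 0 < P x)
    {W : X → Y → ℝ} (hW : ∀ x y, 0 ≤ W x y) {n : ℕ} (x : Fin n → X) (y : Fin n → Y)
    (hpos : ∀ i, 0 < W (x i) (y i)) {c : ℝ} (hc : ∑ i, infoDens P W (x i) (y i) ≤ c) :
    ∏ i, W (x i) (y i) ≤ Real.exp c * ∏ i, outDist P W (y i) := by
  have h : ∏ i, W (x i) (y i)
      = Real.exp (∑ i, infoDens P W (x i) (y i)) * ∏ i, outDist P W (y i) := by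
    rw [Real.exp_sum, ← prod_mul_distrib]
    refine prod_congr rfl fun i _ => ?_
    have hq := outDist_pos hP hW (hpos i)
    rw [infoDens, Real.exp_log (div_pos (hpos i) hq), div_mul_cancel₀ _ hq.ne']
  rw [h]
  exact mul_le_mul_of_nonneg_right (Real.exp_le_exp.2 hc)
    (prod_nonneg fun i _ => (outDist_pos hP hW (hpos i)).le)

/-- The convex combination, with weights `l` and `1 - l`, of the two information densities
centred at their conditional means. -/
def centredDens (l : ℝ) (P : 𝒳 → ℝ) (W1 W2 : 𝒳 → 𝒴 → ℝ) (x : 𝒳) (z : 𝒴 × 𝒴) : ℝ :=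
  l * (infoDens P W1 x z.1 - relEnt (W1 x) (outDist P W1))
    + (1 - l) * (infoDens P W2 x z.2 - relEnt (W2 x) (outDist P W2))

lemma sum_centredDens (l : ℝ) (P : 𝒳 → ℝ) {W1 W2 : 𝒳 → 𝒴 → ℝ} (x : 𝒳)
    (h1 : ∑ y, W1 x y = 1) (h2 : ∑ y, W2 x y = 1) :
    ∑ z : 𝒴 × 𝒴, W1 x z.1 * W2 x z.2 * centredDens l P W1 W2 x z = 0 := by
  have key : ∀ W : 𝒳 → 𝒴 → ℝ, ∑ y, W x y = 1 →
      ∑ y, W x y * (infoDens P W x y - relEnt (W x) (outDist P W)) = 0 := by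
    intro W hW
    simp only [mul_sub, sum_sub_distrib, ← sum_mul, hW, one_mul]
    exact sub_self _
  set A : 𝒴 → ℝ := fun y => infoDens P W1 x y - relEnt (W1 x) (outDist P W1) with hA
  set B : 𝒴 → ℝ := fun y => infoDens P W2 x y - relEnt (W2 x) (outDist P W2) with hB
  calc ∑ z : 𝒴 × 𝒴, W1 x z.1 * W2 x z.2 * centredDens l P W1 W2 x z
      = ∑ y1, ∑ y2, (l * (W1 x y1 * A y1) * W2 x y2
          + (1 - l) * W1 x y1 * (W2 x y2 * B y2)) := by
        rw [Fintype.sum_prod_type]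
        refine sum_congr rfl fun y1 _ => sum_congr rfl fun y2 _ => ?_
        simp only [centredDens, hA, hB]
        ring
    _ = 0 := by
        simp only [sum_add_distrib, ← mul_sum, h2, key W2 h2, key W1 h1, mul_one, mul_zero,
          hA, hB, add_zero]

lemma sum_words_prod {Z : Type*} [Fintype Z] {n : ℕ} (F : (Fin n → Z) → (Fin n → Z) → ℝ) :
    ∑ y1, ∑ y2, F y1 y2 = ∑ z : Fin n → Z × Z, F (fun i => (z i).1) (fun i => (z i).2) := by
  rw [← Fintype.sum_prod_type']
  exact (Fintype.sum_equiv (Equiv.arrowProdEquivProdArrow (Fin n) (fun _ => Z) (fun _ => Z))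
    _ _ fun _ => rfl).symm

lemma sum_prod_words {Z : Type*} [Fintype Z] {q : Z → ℝ} (hq : ∑ z, q z = 1) (n : ℕ) :
    ∑ z : Fin n → Z, ∏ i, q (z i) = 1 := by
  rw [← Fintype.piFinset_univ, ← prod_univ_sum]
  simp [hq]

/-- Under a law in which the observation is independent of the message, the total weight of
the correctly decoded triples is that of a single message. -/
lemma sum_correct {α β : Type*} [Fintype α] [Fintype β] {M : ℕ} {q : α → ℝ}
    {r : Fin M → α → β → ℝ} (hq : ∑ u, q u = 1) (hr : ∀ j u, ∑ v, r j u v = 1)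
    (g : α → Fin M) (c : ℝ) :
    ∑ j, ∑ u, ∑ v, (if g u = j then c * q u * r j u v else 0) = c := by
  rw [sum_comm]
  calc ∑ u, ∑ j, ∑ v, (if g u = j then c * q u * r j u v else 0)
      = ∑ u, ∑ j, (if g u = j then c * q u else 0) := by
        refine sum_congr rfl fun u _ => sum_congr rfl fun j _ => ?_
        split_ifs
        · rw [← mul_sum, hr, mul_one]
        · simp
    _ = c := by simp [← mul_sum, hq]

/-- A meta-converse for two decoders sharing a message, with a Chebyshev bound on the
convex combination of the accumulated information densities. -/
lemma code_size_bound [Nonempty 𝒴] {W1 W2 : 𝒳 → 𝒴 → ℝ}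
    (hW1 : ∀ x y, 0 ≤ W1 x y) (hW1sum : ∀ x, ∑ y, W1 x y = 1)
    (hW2 : ∀ x y, 0 ≤ W2 x y) (hW2sum : ∀ x, ∑ y, W2 x y = 1)
    {P : 𝒳 → ℝ} (hP : IsDist P) (hPpos : ∀ x, 0 < P x) {l C V : ℝ} (hl0 : 0 ≤ l) (hl1 : l ≤ 1)
    (hl : ∀ x, l * relEnt (W1 x) (outDist P W1) + (1 - l) * relEnt (W2 x) (outDist P W2) ≤ C)
    (hV : ∀ x, ∑ z : 𝒴 × 𝒴, W1 x z.1 * W2 x z.2 * centredDens l P W1 W2 x z ^ 2 ≤ V)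
    {n M : ℕ} (hM : 0 < M) {f : Fin M → (Fin n → 𝒴) → (Fin n → 𝒴) → Fin n → 𝒳}
    (hf : Causal n M f) {g1 g2 : (Fin n → 𝒴) → Fin M} {ε : ℝ}
    (he1 : errProb1 W1 W2 n M f g1 ≤ ε) (he2 : errProb2 W1 W2 n M f g2 ≤ ε)
    {a : ℝ} (ha : 0 < a) :
    (M : ℝ) * (1 - 2 * ε - n * V / a ^ 2) ≤ 2 * Real.exp (n * C + a) := by
  have hM' : (0 : ℝ) < M := by exact_mod_cast hM
  set p1 : Fin M → (Fin n → 𝒴) → (Fin n → 𝒴) → ℝ :=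
    fun j y1 y2 => ∏ i, W1 (f j y1 y2 i) (y1 i) with hp1
  set p2 : Fin M → (Fin n → 𝒴) → (Fin n → 𝒴) → ℝ :=
    fun j y1 y2 => ∏ i, W2 (f j y1 y2 i) (y2 i) with hp2
  set D : Fin M → (Fin n → 𝒴) → (Fin n → 𝒴) → ℝ :=
    fun j y1 y2 => ∑ i, centredDens l P W1 W2 (f j y1 y2 i) (y1 i, y2 i) with hD
  set q1 : (Fin n → 𝒴) → ℝ := fun y => ∏ i, outDist P W1 (y i) with hq1
  set q2 : (Fin n → 𝒴) → ℝ := fun y => ∏ i, outDist P W2 (y i) with hq2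
  set c : ℝ := n * C + a with hc
  have hp1nn : ∀ j y1 y2, 0 ≤ p1 j y1 y2 := fun j y1 y2 => prod_nonneg fun i _ => hW1 _ _
  have hp2nn : ∀ j y1 y2, 0 ≤ p2 j y1 y2 := fun j y1 y2 => prod_nonneg fun i _ => hW2 _ _
  have hq1nn : ∀ y, 0 ≤ q1 y := fun y => prod_nonneg fun i _ => outDist_nonneg hP.1 hW1 _
  have hq2nn : ∀ y, 0 ≤ q2 y := fun y => prod_nonneg fun i _ => outDist_nonneg hP.1 hW2 _
  have hmom : ∀ j, (∑ y1, ∑ y2, p1 j y1 y2 * p2 j y1 y2 = 1) ∧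
      ∑ y1, ∑ y2, p1 j y1 y2 * p2 j y1 y2 * D j y1 y2 ^ 2 ≤ n * V := by
    intro j
    have h := causal_moments (fun x (z : 𝒴 × 𝒴) => W1 x z.1 * W2 x z.2)
      (fun x z => mul_nonneg (hW1 _ _) (hW2 _ _))
      (fun x => by simp [Fintype.sum_prod_type, ← mul_sum, hW1sum, hW2sum])
      (centredDens l P W1 W2) V
      (fun x => sum_centredDens l P x (hW1sum x) (hW2sum x)) hV n
      (fun z => f j (fun i => (z i).1) (fun i => (z i).2))
      (fun z z' i h => hf j _ _ _ _ i (fun t ht => by rw [h t ht]) (fun t ht => by rw [h t ht]))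
    rw [sum_words_prod, sum_words_prod]
    simp only [hp1, hp2, hD, ← prod_mul_distrib]
    exact ⟨h.1, h.2.2⟩
  have hc2 : ∀ j y1, ∑ y2, p2 j y1 y2 = 1 := fun j y1 =>
    (causal_moments W2 hW2 hW2sum 0 0 (by simp) (by simp) n (f j y1)
      fun z z' i h => hf j _ _ _ _ i (fun _ _ => rfl) h).1
  have hc1 : ∀ j y2, ∑ y1, p1 j y1 y2 = 1 := fun j y2 =>
    (causal_moments W1 hW1 hW1sum 0 0 (by simp) (by simp) n (fun y1 => f j y1 y2)
      fun z z' i h => hf j _ _ _ _ i h (fun _ _ => rfl)).1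
  have hpt : ∀ j y1 y2, p1 j y1 y2 * p2 j y1 y2 ≤
      (if g1 y1 = j then 0 else p1 j y1 y2 * p2 j y1 y2)
      + (if g2 y2 = j then 0 else p1 j y1 y2 * p2 j y1 y2)
      + p1 j y1 y2 * p2 j y1 y2 * D j y1 y2 ^ 2 / a ^ 2
      + (if g1 y1 = j then Real.exp c * q1 y1 * p2 j y1 y2 else 0)
      + (if g2 y2 = j then Real.exp c * q2 y2 * p1 j y1 y2 else 0) := by
    intro j y1 y2
    have hpp := mul_nonneg (hp1nn j y1 y2) (hp2nn j y1 y2)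
    have t3 : 0 ≤ p1 j y1 y2 * p2 j y1 y2 * D j y1 y2 ^ 2 / a ^ 2 := by positivity
    have t4 : 0 ≤ Real.exp c * q1 y1 * p2 j y1 y2 :=
      mul_nonneg (mul_nonneg (Real.exp_pos c).le (hq1nn y1)) (hp2nn j y1 y2)
    have t5 : 0 ≤ Real.exp c * q2 y2 * p1 j y1 y2 :=
      mul_nonneg (mul_nonneg (Real.exp_pos c).le (hq2nn y2)) (hp1nn j y1 y2)
    have hmain : p1 j y1 y2 * p2 j y1 y2 ≤ p1 j y1 y2 * p2 j y1 y2 * D j y1 y2 ^ 2 / a ^ 2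
        + Real.exp c * q1 y1 * p2 j y1 y2 + Real.exp c * q2 y2 * p1 j y1 y2 := by
      rcases hpp.eq_or_lt with h0 | h0
      · rw [← h0] at t3 ⊢
        linarith
      have hne := h0.ne'
      have hw1 : ∀ i, 0 < W1 (f j y1 y2 i) (y1 i) := fun i =>
        (hW1 _ _).lt_of_ne' (prod_ne_zero_iff.1 (left_ne_zero_of_mul hne) i (mem_univ i))
      have hw2 : ∀ i, 0 < W2 (f j y1 y2 i) (y2 i) := fun i =>
        (hW2 _ _).lt_of_ne' (prod_ne_zero_iff.1 (right_ne_zero_of_mul hne) i (mem_univ i))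
      rcases le_or_gt (∑ i, infoDens P W1 (f j y1 y2 i) (y1 i)) c with hs1 | hs1
      · have h := mul_le_mul_of_nonneg_right
          (prod_le_exp_mul_prod hPpos hW1 _ _ hw1 hs1) (hp2nn j y1 y2)
        simp only [hp1, hq1] at t3 t5 ⊢ h
        linarith
      rcases le_or_gt (∑ i, infoDens P W2 (f j y1 y2 i) (y2 i)) c with hs2 | hs2
      · have h := mul_le_mul_of_nonneg_left
          (prod_le_exp_mul_prod hPpos hW2 _ _ hw2 hs2) (hp1nn j y1 y2)
        simp only [hp2, hq2] at t3 t4 ⊢ h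
        linarith
      have hmean : l * ∑ i, infoDens P W1 (f j y1 y2 i) (y1 i)
          + (1 - l) * ∑ i, infoDens P W2 (f j y1 y2 i) (y2 i) ≤ D j y1 y2 + n * C := by
        have hn : (n : ℝ) * C = ∑ _i : Fin n, C := by simp
        simp only [hD]
        rw [hn, mul_sum, mul_sum, ← sum_add_distrib, ← sum_add_distrib]
        refine sum_le_sum fun i _ => ?_
        unfold centredDens
        linarith [hl (f j y1 y2 i)]
      have haD : a ≤ D j y1 y2 := by
        have i1 := mul_le_mul_of_nonneg_left hs1.le hl0
        have i2 := mul_le_mul_of_nonneg_left hs2.le (sub_nonneg.2 hl1)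
        linarith
      have h1 : 1 ≤ D j y1 y2 ^ 2 / a ^ 2 := by
        rw [one_le_div (by positivity)]
        exact pow_le_pow_left₀ ha.le haD 2
      have h2 := mul_le_mul_of_nonneg_left h1 hpp
      rw [mul_one, ← mul_div_assoc] at h2
      linarith
    split_ifs <;> linarith
  have hE1 : ∑ j, ∑ y1, ∑ y2, (if g1 y1 = j then 0 else p1 j y1 y2 * p2 j y1 y2)
      = M * errProb1 W1 W2 n M f g1 := by
    simp only [errProb1, codeLaw, mul_sum, prod_mul_distrib, hp1, hp2]
    refine sum_congr rfl fun j _ => sum_congr rfl fun y1 _ => sum_congr rfl fun y2 _ => ?_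
    split_ifs
    · simp
    · field_simp
  have hE2 : ∑ j, ∑ y1, ∑ y2, (if g2 y2 = j then 0 else p1 j y1 y2 * p2 j y1 y2)
      = M * errProb2 W1 W2 n M f g2 := by
    simp only [errProb2, codeLaw, mul_sum, prod_mul_distrib, hp1, hp2]
    refine sum_congr rfl fun j _ => sum_congr rfl fun y1 _ => sum_congr rfl fun y2 _ => ?_
    split_ifs
    · simp
    · field_simp
  have hE3 : ∑ j, ∑ y1, ∑ y2, p1 j y1 y2 * p2 j y1 y2 * D j y1 y2 ^ 2 / a ^ 2
      ≤ M * (n * V / a ^ 2) := by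
    simp only [← sum_div]
    rw [← mul_div_assoc]
    refine div_le_div_of_nonneg_right ?_ (by positivity)
    exact (sum_le_sum fun j _ => (hmom j).2).trans_eq (by simp)
  have hE4 : ∑ j, ∑ y1, ∑ y2, (if g1 y1 = j then Real.exp c * q1 y1 * p2 j y1 y2 else 0)
      = Real.exp c :=
    sum_correct (sum_prod_words (sum_outDist hP.2 hW1sum) n) hc2 g1 _
  have hE5 : ∑ j, ∑ y1, ∑ y2, (if g2 y2 = j then Real.exp c * q2 y2 * p1 j y1 y2 else 0)
      = Real.exp c :=
    (sum_congr rfl fun j _ => sum_comm).trans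
      (sum_correct (sum_prod_words (sum_outDist hP.2 hW2sum) n)
        (r := fun j y2 y1 => p1 j y1 y2) hc1 g2 (Real.exp c))
  have htot : ∑ j, ∑ y1, ∑ y2, p1 j y1 y2 * p2 j y1 y2 = M := by simp [hmom]
  have hsum := sum_le_sum fun j (_ : j ∈ univ) => sum_le_sum fun y1 (_ : y1 ∈ univ) =>
    sum_le_sum fun y2 (_ : y2 ∈ univ) => hpt j y1 y2
  simp only [sum_add_distrib] at hsum
  rw [htot, hE1, hE2, hE4, hE5] at hsum
  have i1 := mul_le_mul_of_nonneg_left he1 hM'.le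
  have i2 := mul_le_mul_of_nonneg_left he2 hM'.le
  linarith

/-- **Theorem 4** (converse part): for every `ε ∈ (0, 1/2)`,
`log M*_f(n, ε) ≤ nC + O(√n)`. -/
theorem flf_weak_converse_sqrt_penalty
    (W1 W2 : 𝒳 → 𝒴 → ℝ)
    (hW1 : ∀ x y, 0 ≤ W1 x y) (hW1sum : ∀ x, ∑ y, W1 x y = 1)
    (hW2 : ∀ x y, 0 ≤ W2 x y) (hW2sum : ∀ x, ∑ y, W2 x y = 1)
    (Pstar : 𝒳 → ℝ) (C C1 C2 : ℝ)
    (hPstar : IsDist Pstar) (hPpos : ∀ x, 0 < Pstar x)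
    (hCach : min (mutInfo Pstar W1) (mutInfo Pstar W2) = C)
    (hCmax : ∀ P, IsDist P → min (mutInfo P W1) (mutInfo P W2) ≤ C)
    (hUniq : ∀ P, IsDist P → min (mutInfo P W1) (mutInfo P W2) = C → P = Pstar)
    (hC1 : IsLUB {r | ∃ P, IsDist P ∧ r = mutInfo P W1} C1)
    (hC2 : IsLUB {r | ∃ P, IsDist P ∧ r = mutInfo P W2} C2)
    (hC1gt : C < C1) (hC2gt : C < C2)
    (ε : ℝ) (hε : ε ∈ Set.Ioo (0 : ℝ) (1 / 2)) :
    ∃ K > (0 : ℝ), ∃ n₀ : ℕ, ∀ n ≥ n₀,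
      Real.log (MstarF W1 W2 n ε) ≤ (n : ℝ) * C + K * Real.sqrt n := by
  obtain ⟨l, hl0, hl1, hl⟩ := exists_multiplier hW1 hW1sum hW2 hW2sum hPstar hPpos hCach hCmax
  obtain ⟨x₀⟩ : Nonempty 𝒳 := by
    by_contra! h
    have := hPstar.2
    simp at this
  have : Nonempty 𝒴 := by
    by_contra! h
    have := hW1sum x₀
    simp at this
  set S : 𝒳 → ℝ := fun x =>
    ∑ z : 𝒴 × 𝒴, W1 x z.1 * W2 x z.2 * centredDens l Pstar W1 W2 x z ^ 2 with hS
  have hS0 : ∀ x, 0 ≤ S x := fun x =>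
    sum_nonneg fun z _ => mul_nonneg (mul_nonneg (hW1 x _) (hW2 x _)) (sq_nonneg _)
  set V : ℝ := ∑ x, S x
  have hV : ∀ x, S x ≤ V := fun x => single_le_sum (fun x _ => hS0 x) (mem_univ x)
  have hV0 : 0 ≤ V := sum_nonneg fun x _ => hS0 x
  obtain ⟨hε0, hε1⟩ := hε
  have hδ : 0 < 1 - 2 * ε := by linarith
  set A : ℝ := Real.sqrt (2 * (V + 1) / (1 - 2 * ε)) with hA
  have hApos : 0 < A := Real.sqrt_pos.2 (by positivity)
  have hAsq : A ^ 2 = 2 * (V + 1) / (1 - 2 * ε) := Real.sq_sqrt (by positivity)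
  set L : ℝ := 4 / (1 - 2 * ε) with hL
  have hLpos : 0 < L := by positivity
  refine ⟨A + |Real.log L|, by positivity, 1, fun n hn => ?_⟩
  have hn0 : (0 : ℝ) < n := by exact_mod_cast hn
  have hsqrt : 1 ≤ Real.sqrt n := Real.one_le_sqrt.2 (by exact_mod_cast hn)
  have hbound : ∀ M : ℕ, 0 < M → FLFExists W1 W2 n M ε →
      (M : ℝ) ≤ L * Real.exp (n * C + A * Real.sqrt n) := by
    rintro M hM ⟨f, hf, g1, g2, he1, he2⟩
    have h := code_size_bound hW1 hW1sum hW2 hW2sum hPstar hPpos hl0 hl1 hl hV hM hf he1 he2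
      (a := A * Real.sqrt n) (by positivity)
    have h2 : n * V / (A * Real.sqrt n) ^ 2 ≤ (1 - 2 * ε) / 2 := by
      rw [mul_pow, Real.sq_sqrt hn0.le, hAsq, div_le_iff₀ (by positivity)]
      have : (1 - 2 * ε) / 2 * (2 * (V + 1) / (1 - 2 * ε) * n) = n * (V + 1) := by
        field_simp
      rw [this]
      nlinarith
    have hM' : (0 : ℝ) ≤ M := Nat.cast_nonneg M
    have h3 : (M : ℝ) * ((1 - 2 * ε) / 2) ≤ 2 * Real.exp (n * C + A * Real.sqrt n) :=
      (mul_le_mul_of_nonneg_left (by linarith) hM').trans h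
    rw [hL, div_mul_eq_mul_div, le_div_iff₀ hδ]
    linarith
  have hbdd : BddAbove {M | FLFExists W1 W2 n M ε} := by
    refine ⟨⌈L * Real.exp (n * C + A * Real.sqrt n)⌉₊, fun M hM => ?_⟩
    rcases Nat.eq_zero_or_pos M with h0 | h0
    · simp [h0]
    · exact_mod_cast (hbound M h0 hM).trans (Nat.le_ceil _)
  have hone : FLFExists W1 W2 n 1 ε := by
    refine ⟨fun _ _ _ _ => x₀, fun _ _ _ _ _ _ _ _ => rfl, fun _ => 0, fun _ => 0, ?_, ?_⟩
    · simpa [errProb1] using hε0.le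
    · simpa [errProb2] using hε0.le
  have hpos : 0 < MstarF W1 W2 n ε := le_csSup hbdd hone
  have hfin := hbound _ hpos (Nat.sSup_mem ⟨1, hone⟩ hbdd)
  calc Real.log (MstarF W1 W2 n ε)
      ≤ Real.log (L * Real.exp (n * C + A * Real.sqrt n)) :=
        Real.log_le_log (by exact_mod_cast hpos) hfin
    _ = Real.log L + (n * C + A * Real.sqrt n) := by
        rw [Real.log_mul hLpos.ne' (Real.exp_ne_zero _), Real.log_exp]
    _ ≤ n * C + (A + |Real.log L|) * Real.sqrt n := by
        nlinarith [le_abs_self (Real.log L), abs_nonneg (Real.log L)]
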